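/- Let g: [-1,1]×[-1,1] → R be a C¹ function with g(0,0) = 0. Then the function ξ: [0,1] → R defined by ξ(s) = ∫_s^1 g(u, s/u) (1/u) du for s > 0 and ξ(0) = ∫_0^1 (g(u,0) + g(0,u)) (1/u) du is well-defined (the integrals converge) and absolutely continuous on [0,1]. -/

import Mathlib

open MeasureTheory intervalIntegral

/-- A function whose increments are dominated by those of an absolutely continuous function is
absolutely continuous. -/
theorem AbsolutelyContinuousOnInterval.of_dist_le_mul {X Y : Type*} [PseudoMetricSpace X]
    [PseudoMetricSpace Y] {f : ℝ → X} {h : ℝ → Y} {a b C : ℝ}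
    (hh : AbsolutelyContinuousOnInterval h a b)
    (hfh : ∀ x ∈ Set.uIcc a b, ∀ y ∈ Set.uIcc a b, dist (f x) (f y) ≤ C * dist (h x) (h y)) :
    AbsolutelyContinuousOnInterval f a b := by
  unfold AbsolutelyContinuousOnInterval at hh ⊢
  have hC := hh.const_mul C
  rw [mul_zero] at hC
  refine squeeze_zero' (.of_forall fun E => Finset.sum_nonneg fun _ _ => dist_nonneg) ?_ hC
  filter_upwards [Filter.mem_inf_of_right (Filter.mem_principal_self _)] with E hE
  rw [Finset.mul_sum]
  exact Finset.sum_le_sum fun i hi => hfh _ (hE.1 i hi).1 _ (hE.1 i hi).2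

theorem absolutelyContinuousOnInterval_sqrt :
    AbsolutelyContinuousOnInterval Real.sqrt 0 1 := by
  have hint : IntervalIntegrable (fun x : ℝ => x ^ (-1 / 2 : ℝ)) volume 0 1 :=
    intervalIntegrable_rpow' (by norm_num)
  refine (hint.absolutelyContinuousOnInterval_intervalIntegral
    (c := 0) (by simp)).of_dist_le_mul (C := 1 / 2) fun x _ y _ => ?_
  have key (s : ℝ) : ∫ t in (0 : ℝ)..s, t ^ (-1 / 2 : ℝ) = 2 * s ^ (1 / 2 : ℝ) := by
    rw [integral_rpow (Or.inl (by norm_num))]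
    norm_num
    ring
  rw [key, key, Real.sqrt_eq_rpow, Real.sqrt_eq_rpow, Real.dist_eq, Real.dist_eq, ← mul_sub,
    abs_mul, abs_two]
  linarith

section HyperbolaIntegral

variable {g : ℝ × ℝ → ℝ} {K : NNReal}

/-- The part of the integral of `g` along the hyperbola `x * y = r ^ 2` with `x ≥ r`. -/
noncomputable def hyperbolaIntegral (g : ℝ × ℝ → ℝ) (r : ℝ) : ℝ :=
  ∫ u in r..1, g (u, r ^ 2 / u) / u

theorem mk_sq_div_mem_unitSquare {r u : ℝ} (hr : 0 ≤ r) (hu : u ∈ Set.Ioc r 1) :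
    (u, r ^ 2 / u) ∈ Set.Icc (0 : ℝ) 1 ×ˢ Set.Icc (0 : ℝ) 1 := by
  have hu0 : 0 < u := hr.trans_lt hu.1
  refine ⟨⟨hu0.le, hu.2⟩, by positivity, ?_⟩
  rw [div_le_one hu0]
  nlinarith [hu.1, hu.2]

theorem abs_div_le_of_lipschitzOnWith
    (hg : LipschitzOnWith K g (Set.Icc (0 : ℝ) 1 ×ˢ Set.Icc (0 : ℝ) 1)) (h0 : g (0, 0) = 0)
    {r u : ℝ} (hr : 0 ≤ r) (hu : u ∈ Set.Ioc r 1) : |g (u, r ^ 2 / u) / u| ≤ K := by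
  have hu0 : 0 < u := hr.trans_lt hu.1
  have h := hg.dist_le_mul _ (mk_sq_div_mem_unitSquare hr hu) (0, 0) (by simp)
  have hle : r ^ 2 / u ≤ u := by
    rw [div_le_iff₀ hu0]
    nlinarith [hu.1]
  have hnonneg : 0 ≤ r ^ 2 / u := by positivity
  simp only [Prod.dist_eq, h0, dist_zero_right, Real.norm_eq_abs, abs_of_pos hu0,
    abs_of_nonneg hnonneg, max_eq_left hle] at h
  rwa [abs_div, abs_of_pos hu0, div_le_iff₀ hu0]

theorem continuousOn_mk_sq_div_div
    (hg : ContinuousOn g (Set.Icc (0 : ℝ) 1 ×ˢ Set.Icc (0 : ℝ) 1)) {r : ℝ} (hr : 0 ≤ r) :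
    ContinuousOn (fun u => g (u, r ^ 2 / u) / u) (Set.Ioc r 1) := by
  have hne : ∀ u ∈ Set.Ioc r 1, u ≠ 0 := fun u hu => (hr.trans_lt hu.1).ne'
  refine ContinuousOn.div (hg.comp ?_ fun u hu => mk_sq_div_mem_unitSquare hr hu)
    continuousOn_id hne
  exact continuousOn_id.prodMk (continuousOn_const.div continuousOn_id hne)

theorem integrableOn_mk_sq_div_div
    (hg : LipschitzOnWith K g (Set.Icc (0 : ℝ) 1 ×ˢ Set.Icc (0 : ℝ) 1)) (h0 : g (0, 0) = 0)
    {r : ℝ} (hr : 0 ≤ r) :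
    IntegrableOn (fun u => g (u, r ^ 2 / u) / u) (Set.Ioc r 1) := by
  refine IntegrableOn.of_bound (C := K) (by simp)
    ((continuousOn_mk_sq_div_div hg.continuousOn hr).aestronglyMeasurable measurableSet_Ioc) ?_
  filter_upwards [ae_restrict_mem measurableSet_Ioc] with u hu
  exact abs_div_le_of_lipschitzOnWith hg h0 hr hu

theorem abs_hyperbolaIntegral_sub_le_of_lt
    (hg : LipschitzOnWith K g (Set.Icc (0 : ℝ) 1 ×ˢ Set.Icc (0 : ℝ) 1)) (h0 : g (0, 0) = 0)
    {r q : ℝ} (hr : 0 ≤ r) (hrq : r < q) (hq : q ≤ 1) :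
    |hyperbolaIntegral g r - hyperbolaIntegral g q| ≤ 3 * K * (q - r) := by
  have hq0 : 0 < q := hr.trans_lt hrq
  have hr_int := integrableOn_mk_sq_div_div hg h0 hr
  have hr_head : IntervalIntegrable (fun u => g (u, r ^ 2 / u) / u) volume r q :=
    (intervalIntegrable_iff_integrableOn_Ioc_of_le hrq.le).2
      (hr_int.mono_set (Set.Ioc_subset_Ioc_right hq))
  have hr_tail : IntervalIntegrable (fun u => g (u, r ^ 2 / u) / u) volume q 1 :=
    (intervalIntegrable_iff_integrableOn_Ioc_of_le hq).2
      (hr_int.mono_set (Set.Ioc_subset_Ioc_left hrq.le))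
  have hq_int : IntervalIntegrable (fun u => g (u, q ^ 2 / u) / u) volume q 1 :=
    (intervalIntegrable_iff_integrableOn_Ioc_of_le hq).2
      (integrableOn_mk_sq_div_div hg h0 hq0.le)
  have hsplit : hyperbolaIntegral g r - hyperbolaIntegral g q =
      (∫ u in r..q, g (u, r ^ 2 / u) / u) +
        ∫ u in q..1, (g (u, r ^ 2 / u) / u - g (u, q ^ 2 / u) / u) := by
    rw [integral_sub hr_tail hq_int, hyperbolaIntegral, hyperbolaIntegral,
      ← integral_add_adjacent_intervals hr_head hr_tail]
    ring
  have hhead : ‖∫ u in r..q, g (u, r ^ 2 / u) / u‖ ≤ K * |q - r| := by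
    refine norm_integral_le_of_norm_le_const fun u hu => ?_
    rw [Set.uIoc_of_le hrq.le] at hu
    exact abs_div_le_of_lipschitzOnWith hg h0 hr ⟨hu.1, hu.2.trans hq⟩
  have hzero : (0 : ℝ) ∉ Set.uIcc q 1 := by
    rw [Set.uIcc_of_le hq]
    exact fun h => absurd h.1 (not_le.2 hq0)
  have htail : ‖∫ u in q..1, (g (u, r ^ 2 / u) / u - g (u, q ^ 2 / u) / u)‖ ≤
      ∫ u in q..1, K * (q ^ 2 - r ^ 2) * u ^ (-2 : ℤ) := by
    refine norm_integral_le_of_norm_le hq (.of_forall fun u hu => ?_)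
      ((intervalIntegrable_zpow (Or.inr hzero)).const_mul _)
    have hu0 : 0 < u := hq0.trans hu.1
    have h := hg.dist_le_mul _ (mk_sq_div_mem_unitSquare hr ⟨hrq.trans hu.1, hu.2⟩) _
      (mk_sq_div_mem_unitSquare hq0.le hu)
    have hd : |r ^ 2 / u - q ^ 2 / u| = (q ^ 2 - r ^ 2) / u := by
      rw [← sub_div, abs_div, abs_of_pos hu0, abs_sub_comm, abs_of_nonneg (by nlinarith)]
    rw [Prod.dist_eq, dist_self, max_eq_right dist_nonneg, Real.dist_eq, Real.dist_eq, hd] at h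
    rw [← sub_div, Real.norm_eq_abs, abs_div, abs_of_pos hu0, div_le_iff₀ hu0]
    refine h.trans_eq ?_
    rw [zpow_neg]
    norm_cast
    field_simp
  have hval : ∫ u in q..1, K * (q ^ 2 - r ^ 2) * u ^ (-2 : ℤ) ≤ 2 * K * (q - r) := by
    rw [intervalIntegral.integral_const_mul, integral_zpow (Or.inr ⟨by norm_num, hzero⟩)]
    norm_num
    have hKr : 0 ≤ (K : ℝ) * (q - r) := mul_nonneg K.2 (by linarith)
    have hfac : (q + r) * (q⁻¹ - 1) ≤ 2 := by
      have : q * q⁻¹ = 1 := mul_inv_cancel₀ hq0.ne'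
      have hinv : 0 < q⁻¹ := inv_pos.2 hq0
      nlinarith
    calc (K : ℝ) * (q ^ 2 - r ^ 2) * ((1 - q⁻¹) / -1)
        = K * (q - r) * ((q + r) * (q⁻¹ - 1)) := by ring
      _ ≤ K * (q - r) * 2 := by gcongr
      _ = 2 * K * (q - r) := by ring
  rw [hsplit]
  rw [Real.norm_eq_abs, abs_of_pos (sub_pos.2 hrq)] at hhead
  rw [Real.norm_eq_abs] at htail
  refine (abs_add_le _ _).trans ?_
  linarith

theorem dist_hyperbolaIntegral_le
    (hg : LipschitzOnWith K g (Set.Icc (0 : ℝ) 1 ×ˢ Set.Icc (0 : ℝ) 1)) (h0 : g (0, 0) = 0)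
    {r q : ℝ} (hr : r ∈ Set.Icc (0 : ℝ) 1) (hq : q ∈ Set.Icc (0 : ℝ) 1) :
    dist (hyperbolaIntegral g r) (hyperbolaIntegral g q) ≤ 3 * K * dist r q := by
  wlog hrq : r ≤ q generalizing r q
  · rw [dist_comm, dist_comm r]
    exact this hq hr (le_of_not_ge hrq)
  rcases hrq.eq_or_lt with rfl | hrq
  · simp
  rw [dist_comm r, Real.dist_eq, Real.dist_eq, abs_of_pos (sub_pos.2 hrq)]
  exact abs_hyperbolaIntegral_sub_le_of_lt hg h0 hr.1 hrq hq.2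

theorem integral_div_eq_hyperbolaIntegral_add_swap
    (hg : LipschitzOnWith K g (Set.Icc (0 : ℝ) 1 ×ˢ Set.Icc (0 : ℝ) 1)) {r : ℝ}
    (hr : 0 < r) (hr1 : r ≤ 1) :
    ∫ u in r ^ 2..1, g (u, r ^ 2 / u) / u =
      hyperbolaIntegral g r + hyperbolaIntegral (g ∘ Prod.swap) r := by
  have hr2 : r ^ 2 ≤ r := by nlinarith
  have hcont : ContinuousOn (fun u => g (u, r ^ 2 / u) / u) (Set.Icc (r ^ 2) 1) := by
    have hpos : ∀ u ∈ Set.Icc (r ^ 2) 1, 0 < u := fun u hu => (pow_pos hr 2).trans_le hu.1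
    have hne : ∀ u ∈ Set.Icc (r ^ 2) 1, u ≠ 0 := fun u hu => (hpos u hu).ne'
    refine ContinuousOn.div (hg.continuousOn.comp ?_ fun u hu => ?_) continuousOn_id hne
    · exact continuousOn_id.prodMk (continuousOn_const.div continuousOn_id hne)
    · have hu0 := hpos u hu
      exact ⟨⟨hu0.le, hu.2⟩, by positivity, (div_le_one hu0).2 hu.1⟩
  have hlow : ∫ u in r ^ 2..r, g (u, r ^ 2 / u) / u = hyperbolaIntegral (g ∘ Prod.swap) r := by
    have hpos : ∀ v ∈ Set.uIcc r 1, 0 < v := fun v hv => by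
      rw [Set.uIcc_of_le hr1] at hv
      exact hr.trans_le hv.1
    have hsub := integral_comp_mul_deriv' (a := r) (b := 1) (f := fun v => r ^ 2 / v)
      (f' := fun v => -(r ^ 2 / v ^ 2)) (g := fun u => g (u, r ^ 2 / u) / u)
      (fun v hv => by
        convert! (hasDerivAt_inv (hpos v hv).ne').const_mul (r ^ 2) using 1
        simp [div_eq_mul_inv])
      (ContinuousOn.neg (continuousOn_const.div (continuousOn_id.pow 2)
        fun v hv => (pow_pos (hpos v hv) 2).ne'))
      (hcont.mono (by
        rintro _ ⟨v, hv, rfl⟩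
        have hv0 := hpos v hv
        rw [Set.uIcc_of_le hr1] at hv
        refine ⟨?_, ?_⟩
        · rw [le_div_iff₀ hv0]
          nlinarith [hv.2, sq_nonneg r]
        · rw [div_le_one hv0]
          exact hr2.trans hv.1))
    have hrr : r ^ 2 / r = r := by field_simp
    simp only [hrr, div_one] at hsub
    rw [integral_symm, ← hsub, ← intervalIntegral.integral_neg, hyperbolaIntegral]
    refine integral_congr fun v hv => ?_
    have hv0 := hpos v hv
    have hvv : r ^ 2 / (r ^ 2 / v) = v := by field_simp
    simp only [Function.comp_apply, Prod.swap_prod_mk, hvv]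
    field_simp
  rw [← hlow, hyperbolaIntegral, add_comm]
  refine (integral_add_adjacent_intervals ?_ ?_).symm
  · exact (hcont.mono (Set.Icc_subset_Icc_right hr1)).intervalIntegrable_of_Icc hr2
  · exact (hcont.mono (Set.Icc_subset_Icc_left hr2)).intervalIntegrable_of_Icc hr1

end HyperbolaIntegral

theorem stmt6 (g : ℝ × ℝ → ℝ)
    (hg : ContDiffOn ℝ 1 g (Set.Icc (-1 : ℝ) 1 ×ˢ Set.Icc (-1 : ℝ) 1))
    (h0 : g (0, 0) = 0) :
    IntegrableOn (fun u => (g (u, 0) + g (0, u)) / u) (Set.Ioc (0 : ℝ) 1) ∧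
      ∃ f : ℝ → ℝ, IntegrableOn f (Set.Icc (0 : ℝ) 1) ∧
        ∀ s ∈ Set.Icc (0 : ℝ) 1,
          (if 0 < s then ∫ u in s..1, g (u, s / u) / u
            else ∫ u in (0 : ℝ)..1, (g (u, 0) + g (0, u)) / u)
          = (∫ u in (0 : ℝ)..1, (g (u, 0) + g (0, u)) / u) + ∫ t in (0 : ℝ)..s, f t := by
  obtain ⟨K, hK⟩ := hg.exists_lipschitzOnWith one_ne_zero
    ((convex_Icc _ _).prod (convex_Icc _ _)) (isCompact_Icc.prod isCompact_Icc)
  have hsub : Set.Icc (0 : ℝ) 1 ⊆ Set.Icc (-1) 1 := Set.Icc_subset_Icc_left (by norm_num)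
  replace hK := hK.mono (Set.prod_mono hsub hsub)
  have hK' : LipschitzOnWith K (g ∘ Prod.swap) (Set.Icc (0 : ℝ) 1 ×ˢ Set.Icc (0 : ℝ) 1) := by
    refine LipschitzOnWith.of_dist_le_mul fun x hx y hy => ?_
    refine (hK.dist_le_mul x.swap ⟨hx.2, hx.1⟩ y.swap ⟨hy.2, hy.1⟩).trans_eq ?_
    simp [Prod.dist_eq, max_comm]
  have h0' : (g ∘ Prod.swap) (0, 0) = 0 := h0
  have hint := integrableOn_mk_sq_div_div hK h0 le_rfl
  have hint' := integrableOn_mk_sq_div_div hK' h0' le_rfl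
  simp only [ne_eq, OfNat.ofNat_ne_zero, not_false_eq_true, zero_pow, zero_div,
    Function.comp_apply, Prod.swap_prod_mk] at hint hint'
  refine ⟨by
    simp only [add_div]
    exact Integrable.add hint hint', ?_⟩
  set ξ : ℝ → ℝ := fun s =>
    hyperbolaIntegral g (√s) + hyperbolaIntegral (g ∘ Prod.swap) (√s) with hξ
  have hξ_zero : ξ 0 = ∫ u in (0 : ℝ)..1, (g (u, 0) + g (0, u)) / u := by
    simp only [hξ, hyperbolaIntegral, Real.sqrt_zero, ne_eq, OfNat.ofNat_ne_zero,
      not_false_eq_true, zero_pow, zero_div, Function.comp_apply, Prod.swap_prod_mk, add_div]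
    exact (integral_add
      ((intervalIntegrable_iff_integrableOn_Ioc_of_le zero_le_one).2 hint)
      ((intervalIntegrable_iff_integrableOn_Ioc_of_le zero_le_one).2 hint')).symm
  have hξ_pos (s : ℝ) (hs : 0 < s) (hs1 : s ≤ 1) : ξ s = ∫ u in s..1, g (u, s / u) / u := by
    have h := integral_div_eq_hyperbolaIntegral_add_swap hK (Real.sqrt_pos.2 hs)
      (Real.sqrt_le_one.2 hs1)
    rw [Real.sq_sqrt hs.le] at h
    exact h.symm
  have hsqrt_mem : ∀ s ∈ Set.uIcc (0 : ℝ) 1, √s ∈ Set.Icc (0 : ℝ) 1 := fun s hs => by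
    rw [Set.uIcc_of_le zero_le_one] at hs
    exact ⟨Real.sqrt_nonneg s, Real.sqrt_le_one.2 hs.2⟩
  have hξ_ac : AbsolutelyContinuousOnInterval ξ 0 1 :=
    absolutelyContinuousOnInterval_sqrt.of_dist_le_mul (C := 3 * K + 3 * K) fun x hx y hy => by
      rw [add_mul]
      exact (dist_add_add_le _ _ _ _).trans (add_le_add
        (dist_hyperbolaIntegral_le hK h0 (hsqrt_mem x hx) (hsqrt_mem y hy))
        (dist_hyperbolaIntegral_le hK' h0' (hsqrt_mem x hx) (hsqrt_mem y hy)))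
  refine ⟨deriv ξ, (intervalIntegrable_iff_integrableOn_Icc_of_le zero_le_one).1
    hξ_ac.intervalIntegrable_deriv, fun s hs => ?_⟩
  have hs' : Set.uIcc 0 s ⊆ Set.uIcc (0 : ℝ) 1 := by
    rw [Set.uIcc_of_le hs.1, Set.uIcc_of_le zero_le_one]
    exact Set.Icc_subset_Icc_right hs.2
  rw [(hξ_ac.mono hs').integral_deriv_eq_sub, ← hξ_zero, add_sub_cancel]
  split_ifs with hpos
  · exact (hξ_pos s hpos hs.2).symm
  · rw [le_antisymm (not_lt.1 hpos) hs.1]
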